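/- arXiv:2003.00336 — 4 statements merged into one kernel-verified Lean document; each statement's English description precedes it below -/
import Mathlib

section
/- For every 3CNF formula φ with m clauses, φ is satisfiable if and only if the constructed 3DM instance (W, X, Y, M) admits a perfect matching. -/
/-!
The 3SAT → 3DM reduction (linear size).

A 3CNF formula with `n` variables and `m` clauses is a function
`φ : Fin m → Fin 3 → Fin n × Bool`, sending a clause index and a slot to a
literal `(variable, polarity)` (`true` = positive occurrence).

For each variable `i`, `mocc i` is the number of occurrences of `i` among all
clauses, and `e i` enumerates these occurrences (so in particular
`∑ i, mocc i = 3 * m`); `hpos` says every variable occurs at least once.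

Vertices:
* `W` consists of the nodes `c_k[i]` (encoded `(⟨i,k⟩, true)`) and `c'_k[i]`
  (encoded `(⟨i,k⟩, false)`);
* `X` consists of the `a_k[i]` (left summand) and `t[j] = (j,0)`,
  `tf_1[j] = (j,1)`, `tf_2[j] = (j,2)` (right summand);
* `Y` consists of the `b_k[i]` (left summand) and `t'[j] = (j,0)`,
  `tf'_1[j] = (j,1)`, `tf'_2[j] = (j,2)` (right summand).
-/

/-- A literal: a variable together with a polarity (`true` = positive). -/
abbrev Lit (n : ℕ) : Type := Fin n × Bool

/-- `σ` satisfies the 3CNF formula `φ` iff every clause contains a literal whose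
variable is assigned its polarity. -/
def Satisfies {n m : ℕ} (φ : Fin m → Fin 3 → Lit n) (σ : Fin n → Bool) : Prop :=
  ∀ j : Fin m, ∃ s : Fin 3, σ (φ j s).1 = (φ j s).2

/-- The occurrences of variable `i` in `φ`: pairs (clause, slot) whose literal
has variable `i`. -/
def Occ {n m : ℕ} (φ : Fin m → Fin 3 → Lit n) (i : Fin n) : Type :=
  {p : Fin m × Fin 3 // (φ p.1 p.2).1 = i}

/-- The set `W`: nodes `c_k[i]` (flag `true`) and `c'_k[i]` (flag `false`). -/
abbrev Wt {n : ℕ} (mocc : Fin n → ℕ) : Type := (Σ i : Fin n, Fin (mocc i)) × Bool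

/-- The set `X`: nodes `a_k[i]`, plus `t[j] = (j,0)`, `tf_1[j] = (j,1)`, `tf_2[j] = (j,2)`. -/
abbrev Xt {n : ℕ} (mocc : Fin n → ℕ) (m : ℕ) : Type :=
  (Σ i : Fin n, Fin (mocc i)) ⊕ (Fin m × Fin 3)

/-- The set `Y`: nodes `b_k[i]`, plus `t'[j] = (j,0)`, `tf'_1[j] = (j,1)`, `tf'_2[j] = (j,2)`. -/
abbrev Yt {n : ℕ} (mocc : Fin n → ℕ) (m : ℕ) : Type :=
  (Σ i : Fin n, Fin (mocc i)) ⊕ (Fin m × Fin 3)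

/-- `k + 1` taken modulo `mocc i` (cyclic index arithmetic in the gadget). -/
def nextIdx {n : ℕ} {mocc : Fin n → ℕ} (hpos : ∀ i, 0 < mocc i) {i : Fin n}
    (k : Fin (mocc i)) : Fin (mocc i) :=
  ⟨(k.1 + 1) % mocc i, Nat.mod_lt _ (hpos i)⟩

variable {n m : ℕ}

/-- The index of the occurrence `(j, s)` among the occurrences of its variable,
via the enumeration `e`. -/
def occIdx (φ : Fin m → Fin 3 → Lit n) {mocc : Fin n → ℕ}
    (e : ∀ i, Fin (mocc i) ≃ Occ φ i) (j : Fin m) (s : Fin 3) :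
    Fin (mocc (φ j s).1) :=
  (e (φ j s).1).symm ⟨(j, s), rfl⟩

/-- Truth-setting triple `(c_k[i], a_k[i], b_k[i])` ("variable `i` true"). -/
def trueTriple {n : ℕ} (mocc : Fin n → ℕ) (m : ℕ) (i : Fin n) (k : Fin (mocc i)) :
    Wt mocc × Xt mocc m × Yt mocc m :=
  ((⟨i, k⟩, true), Sum.inl ⟨i, k⟩, Sum.inl ⟨i, k⟩)

/-- Truth-setting triple `(c'_k[i], a_{k+1}[i], b_k[i])` ("variable `i` false"). -/
def falseTriple {n : ℕ} {mocc : Fin n → ℕ} (hpos : ∀ i, 0 < mocc i) (m : ℕ)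
    (i : Fin n) (k : Fin (mocc i)) :
    Wt mocc × Xt mocc m × Yt mocc m :=
  ((⟨i, k⟩, false), Sum.inl ⟨i, nextIdx hpos k⟩, Sum.inl ⟨i, k⟩)

/-- Satisfaction triple for the occurrence in clause `j`, slot `s`:
`(c'_k[i], t[j], t'[j])` if the occurrence is positive, `(c_k[i], t[j], t'[j])`
if it is negated (where `k` is the index of this occurrence). -/
def satTriple (φ : Fin m → Fin 3 → Lit n) {mocc : Fin n → ℕ}
    (e : ∀ i, Fin (mocc i) ≃ Occ φ i) (j : Fin m) (s : Fin 3) :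
    Wt mocc × Xt mocc m × Yt mocc m :=
  ((⟨(φ j s).1, occIdx φ e j s⟩, !(φ j s).2), Sum.inr (j, 0), Sum.inr (j, 0))

/-- Garbage-collection triple `(c_k[i], tf_r[j], tf'_r[j])` (for `b = true`) or
`(c'_k[i], tf_r[j], tf'_r[j])` (for `b = false`), `r ∈ {1, 2}`. -/
def garbTriple (φ : Fin m → Fin 3 → Lit n) {mocc : Fin n → ℕ}
    (e : ∀ i, Fin (mocc i) ≃ Occ φ i) (j : Fin m) (s : Fin 3) (b : Bool) (r : Fin 3) :
    Wt mocc × Xt mocc m × Yt mocc m :=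
  ((⟨(φ j s).1, occIdx φ e j s⟩, b), Sum.inr (j, r), Sum.inr (j, r))

/-- The match set `M` of the constructed 3DM instance. -/
def Matches (φ : Fin m → Fin 3 → Lit n) (mocc : Fin n → ℕ)
    (hpos : ∀ i, 0 < mocc i) (e : ∀ i, Fin (mocc i) ≃ Occ φ i) :
    Set (Wt mocc × Xt mocc m × Yt mocc m) :=
  {t | ∃ i k, t = trueTriple mocc m i k}
    ∪ {t | ∃ i k, t = falseTriple hpos m i k}
    ∪ {t | ∃ j s, t = satTriple φ e j s}
    ∪ {t | ∃ j, ∃ s, ∃ b : Bool, ∃ r : Fin 3, r ≠ 0 ∧ t = garbTriple φ e j s b r}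

/-- `M'` is a perfect matching of the 3DM instance with match set `M`:
`M' ⊆ M` and every element of `W`, of `X`, and of `Y` appears in exactly one
triple of `M'`. -/
def IsPerfectMatching {α β γ : Type*} (M M' : Set (α × β × γ)) : Prop :=
  M' ⊆ M ∧ (∀ w : α, ∃! t, t ∈ M' ∧ t.1 = w)
    ∧ (∀ x : β, ∃! t, t ∈ M' ∧ t.2.1 = x)
    ∧ (∀ y : γ, ∃! t, t ∈ M' ∧ t.2.2 = y)

theorem existsUnique_mem_range {ι τ δ : Type*} (f : ι → τ) (g : τ → δ)
    (hg : Function.Bijective fun a => g (f a)) (d : δ) : ∃! t, t ∈ Set.range f ∧ g t = d := by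
  obtain ⟨a, ha⟩ := hg.2 d
  refine ⟨f a, ⟨⟨a, rfl⟩, ha⟩, ?_⟩
  rintro _ ⟨⟨a', rfl⟩, ha'⟩
  exact congrArg f (hg.1 (ha'.trans ha.symm))

/-- The range of a family of triples is a perfect matching as soon as each coordinate of the
family is a bijection. -/
theorem isPerfectMatching_range {ι α β γ : Type*} {M : Set (α × β × γ)} (f : ι → α × β × γ)
    (hM : ∀ a, f a ∈ M) (h₁ : Function.Bijective fun a => (f a).1)
    (h₂ : Function.Bijective fun a => (f a).2.1) (h₃ : Function.Bijective fun a => (f a).2.2) :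
    IsPerfectMatching M (Set.range f) := by
  exact ⟨Set.range_subset_iff.2 hM, existsUnique_mem_range f _ h₁,
    existsUnique_mem_range f _ h₂, existsUnique_mem_range f _ h₃⟩

theorem nextIdx_bijective {mocc : Fin n → ℕ} (hpos : ∀ i, 0 < mocc i) (i : Fin n) :
    Function.Bijective (nextIdx hpos (i := i)) := by
  refine Function.Injective.bijective_of_finite fun k l h => ?_
  have h' : (k.1 + 1) ≡ (l.1 + 1) [MOD mocc i] := congrArg Fin.val h
  exact Fin.ext ((Nat.ModEq.add_right_cancel' 1 h').eq_of_lt_of_lt k.2 l.2)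

/-- Literal slots correspond bijectively to indexed occurrences of variables. -/
theorem occIdx_bijective (φ : Fin m → Fin 3 → Lit n) {mocc : Fin n → ℕ}
    (e : ∀ i, Fin (mocc i) ≃ Occ φ i) :
    Function.Bijective fun q : Fin m × Fin 3 =>
      (⟨(φ q.1 q.2).1, occIdx φ e q.1 q.2⟩ : Σ i : Fin n, Fin (mocc i)) := by
  have left : Function.LeftInverse
      (fun p : Σ i : Fin n, Fin (mocc i) => (e p.1 p.2).1) fun q : Fin m × Fin 3 =>
        (⟨(φ q.1 q.2).1, occIdx φ e q.1 q.2⟩ : Σ i : Fin n, Fin (mocc i)) := by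
    intro q
    exact congrArg Subtype.val ((e (φ q.1 q.2).1).apply_symm_apply ⟨q, rfl⟩)
  refine ⟨left.injective, ?_⟩
  rintro ⟨i, k⟩
  obtain ⟨⟨⟨j, s⟩, h⟩, hk⟩ : ∃ o, e i k = o := ⟨_, rfl⟩
  refine ⟨(j, s), ?_⟩
  dsimp only at h
  subst h
  simp only [occIdx, ← hk, Equiv.symm_apply_apply]

/-- A satisfying assignment gives a perfect matching. -/
theorem Satisfies.exists_perfectMatching {φ : Fin m → Fin 3 → Lit n} {σ : Fin n → Bool}
    (hσ : Satisfies φ σ) (mocc : Fin n → ℕ) (hpos : ∀ i, 0 < mocc i)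
    (e : ∀ i, Fin (mocc i) ≃ Occ φ i) :
    ∃ M' : Set (Wt mocc × Xt mocc m × Yt mocc m),
      IsPerfectMatching (Matches φ mocc hpos e) M' := by
  choose c hc using hσ
  -- the slots of clause `j` are rotated so that the satisfied slot `c j` meets `t[j]`
  let rot : Fin m × Fin 3 → Fin m × Fin 3 := fun q => (q.1, q.2 - c q.1)
  have hrot : Function.Bijective rot := by
    refine Function.Injective.bijective_of_finite ?_
    rintro ⟨j, s⟩ ⟨j', s'⟩ h
    obtain ⟨rfl, h⟩ := Prod.ext_iff.1 h
    exact Prod.ext rfl (sub_left_injective h)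
  let step : (Σ i : Fin n, Fin (mocc i)) → Σ i : Fin n, Fin (mocc i) :=
    fun p => ⟨p.1, if σ p.1 then p.2 else nextIdx hpos p.2⟩
  have hstep : Function.Bijective step := by
    refine Function.Injective.bijective_of_finite ?_
    rintro ⟨i, k⟩ ⟨i', l⟩ h
    obtain ⟨rfl, h⟩ := Sigma.mk.inj_iff.1 h
    by_cases hi : σ i
    · simpa [hi] using h
    · exact congrArg (Sigma.mk i) ((nextIdx_bijective hpos i).1 (by simpa [hi] using h))
  let occ : Fin m × Fin 3 → Σ i : Fin n, Fin (mocc i) :=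
    fun q => ⟨(φ q.1 q.2).1, occIdx φ e q.1 q.2⟩
  have hocc : Function.Bijective occ := occIdx_bijective φ e
  let f : (Σ i : Fin n, Fin (mocc i)) ⊕ (Fin m × Fin 3) → Wt mocc × Xt mocc m × Yt mocc m :=
    fun a => (Sum.elim (fun p => (p, σ p.1)) (fun q => (occ q, !σ (occ q).1)) a,
      Sum.map step rot a, Sum.map id rot a)
  refine ⟨Set.range f, isPerfectMatching_range f ?_ ⟨?_, ?_⟩
    ⟨hstep.1.sumMap hrot.1, hstep.2.sumMap hrot.2⟩
    ⟨Function.injective_id.sumMap hrot.1, Function.surjective_id.sumMap hrot.2⟩⟩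
  · rintro (⟨i, k⟩ | ⟨j, s⟩)
    · by_cases hi : σ i
      · exact .inl (.inl (.inl ⟨i, k, by simp [f, step, trueTriple, hi]⟩))
      · exact .inl (.inl (.inr ⟨i, k, by simp [f, step, falseTriple, hi]⟩))
    · by_cases hs : s = c j
      · subst hs
        exact .inl (.inr ⟨j, c j, by simp [f, occ, rot, satTriple, hc]⟩)
      · exact .inr ⟨j, s, !σ (φ j s).1, s - c j, sub_ne_zero.2 hs, rfl⟩
  · rintro (p | q) (p' | q') h
    · simpa [f] using congrArg Prod.fst h
    · obtain ⟨rfl, h⟩ := Prod.ext_iff.1 h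
      simp [f] at h
    · obtain ⟨h₁, h₂⟩ := Prod.ext_iff.1 h
      simp only [f, Sum.elim_inl, Sum.elim_inr] at h₁ h₂
      simp [← h₁] at h₂
    · exact congrArg Sum.inr (hocc.1 (congrArg Prod.fst h))
  · rintro ⟨p, b⟩
    by_cases hb : b = σ p.1
    · exact ⟨.inl p, by simp [f, hb]⟩
    · obtain ⟨q, rfl⟩ := hocc.2 p
      exact ⟨.inr q, by simpa [f] using (Bool.eq_not.2 hb).symm⟩

section PerfectMatching

variable {φ : Fin m → Fin 3 → Lit n} {mocc : Fin n → ℕ} {hpos : ∀ i, 0 < mocc i}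
  {e : ∀ i, Fin (mocc i) ≃ Occ φ i} {M' : Set (Wt mocc × Xt mocc m × Yt mocc m)}

/-- A perfect matching covers `b_k[i]` by exactly one of the two truth-setting triples. -/
theorem IsPerfectMatching.falseTriple_mem_iff (h : IsPerfectMatching (Matches φ mocc hpos e) M')
    (i : Fin n) (k : Fin (mocc i)) :
    falseTriple hpos m i k ∈ M' ↔ trueTriple mocc m i k ∉ M' := by
  obtain ⟨hM, -, -, hY⟩ := h
  constructor
  · intro hf ht
    have := (hY (.inl ⟨i, k⟩)).unique ⟨hf, rfl⟩ ⟨ht, rfl⟩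
    simp [falseTriple, trueTriple] at this
  · intro ht
    obtain ⟨t, ⟨htM, hty⟩, -⟩ := hY (.inl ⟨i, k⟩)
    obtain ((⟨i', k', rfl⟩ | ⟨i', k', rfl⟩) | ⟨j, s, rfl⟩) | ⟨j, s, b, r, -, rfl⟩ := hM htM
    · cases hty
      exact absurd htM ht
    · cases hty
      exact htM
    · cases hty
    · cases hty

/-- The truth-setting triples of a variable are chosen consistently around its cycle. -/
theorem IsPerfectMatching.trueTriple_nextIdx_mem_iff
    (h : IsPerfectMatching (Matches φ mocc hpos e) M') (i : Fin n) (k : Fin (mocc i)) :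
    trueTriple mocc m i (nextIdx hpos k) ∈ M' ↔ trueTriple mocc m i k ∈ M' := by
  have hF := h.falseTriple_mem_iff i k
  obtain ⟨hM, -, hX, -⟩ := h
  constructor
  · intro ht
    by_contra hk
    have := (hX (.inl ⟨i, nextIdx hpos k⟩)).unique ⟨hF.2 hk, rfl⟩ ⟨ht, rfl⟩
    simp [falseTriple, trueTriple] at this
  · intro hk
    obtain ⟨t, ⟨htM, htx⟩, -⟩ := hX (.inl ⟨i, nextIdx hpos k⟩)
    obtain ((⟨i', k', rfl⟩ | ⟨i', k', rfl⟩) | ⟨j, s, rfl⟩) | ⟨j, s, b, r, -, rfl⟩ := hM htM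
    · cases htx
      exact htM
    · simp only [falseTriple, Sum.inl.injEq, Sigma.mk.injEq] at htx
      obtain ⟨rfl, htx⟩ := htx
      obtain rfl := (nextIdx_bijective hpos i').1 (eq_of_heq htx)
      exact absurd hk (hF.1 htM)
    · cases htx
    · cases htx

theorem IsPerfectMatching.trueTriple_mem_iff_zero
    (h : IsPerfectMatching (Matches φ mocc hpos e) M') (i : Fin n) (k : Fin (mocc i)) :
    trueTriple mocc m i k ∈ M' ↔ trueTriple mocc m i ⟨0, hpos i⟩ ∈ M' := by
  obtain ⟨k, hk⟩ := k
  induction k with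
  | zero => rfl
  | succ k ih =>
    have hnext : nextIdx hpos ⟨k, by omega⟩ = (⟨k + 1, hk⟩ : Fin (mocc i)) :=
      Fin.ext (Nat.mod_eq_of_lt hk)
    rw [← ih (by omega), ← hnext]
    exact h.trueTriple_nextIdx_mem_iff i _

/-- A perfect matching gives a satisfying assignment. -/
theorem IsPerfectMatching.exists_satisfies
    (h : IsPerfectMatching (Matches φ mocc hpos e) M') : ∃ σ : Fin n → Bool, Satisfies φ σ := by
  classical
  refine ⟨fun i => decide (trueTriple mocc m i ⟨0, hpos i⟩ ∈ M'), fun j => ?_⟩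
  have hT := h.trueTriple_mem_iff_zero
  have hF := h.falseTriple_mem_iff
  obtain ⟨hM, hW, hX, -⟩ := h
  obtain ⟨t, ⟨htM, htx⟩, -⟩ := hX (.inr (j, 0))
  obtain ((⟨i', k', rfl⟩ | ⟨i', k', rfl⟩) | ⟨j', s, rfl⟩) | ⟨j', s, b, r, hr, rfl⟩ := hM htM
  · cases htx
  · cases htx
  · cases htx
    refine ⟨s, ?_⟩
    beta_reduce
    rw [← decide_eq_decide.2 (hT _ (occIdx φ e j s))]
    cases hp : (φ j s).2
    · refine decide_eq_false fun ht => ?_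
      have := (hW _).unique ⟨ht, rfl⟩ ⟨htM, by simp [satTriple, trueTriple, hp]⟩
      simp [satTriple, trueTriple] at this
    · refine decide_eq_true (by_contra fun ht => ?_)
      have := (hW _).unique ⟨(hF _ _).2 ht, rfl⟩ ⟨htM, by simp [satTriple, falseTriple, hp]⟩
      simp [satTriple, falseTriple] at this
  · exact absurd (congrArg Prod.snd (Sum.inr.inj htx)) hr

end PerfectMatching

/-- For every 3CNF formula `φ` with `m` clauses, `φ` is
satisfiable iff the constructed 3DM instance admits a perfect matching. -/
theorem satisfiable_iff_exists_perfectMatching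
    {n m : ℕ} (φ : Fin m → Fin 3 → Lit n) (mocc : Fin n → ℕ)
    (hpos : ∀ i, 0 < mocc i) (e : ∀ i, Fin (mocc i) ≃ Occ φ i) :
    (∃ σ : Fin n → Bool, Satisfies φ σ) ↔
      ∃ M' : Set (Wt mocc × Xt mocc m × Yt mocc m),
        IsPerfectMatching (Matches φ mocc hpos e) M' := by
  constructor
  · rintro ⟨σ, hσ⟩
    exact hσ.exists_perfectMatching mocc hpos e
  · rintro ⟨M', hM'⟩
    exact hM'.exists_satisfies
end

section
/- If the constructed 3DM instance (W, X, Y, M) admits a perfect matching, then the 3CNF formula φ is satisfiable. -/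
variable {n m : ℕ}

/-- A property of indices that is stable under `nextIdx` and holds somewhere holds everywhere. -/
theorem forall_of_nextIdx {n : ℕ} {mocc : Fin n → ℕ} (hpos : ∀ i, 0 < mocc i) {i : Fin n}
    {P : Fin (mocc i) → Prop} (hP : ∀ k, P k → P (nextIdx hpos k)) {k₀ : Fin (mocc i)}
    (h₀ : P k₀) (k : Fin (mocc i)) : P k := by
  have key : ∀ d : ℕ, P ⟨(k₀.1 + d) % mocc i, Nat.mod_lt _ (hpos i)⟩ := by
    intro d
    induction d with
    | zero => simpa [Nat.mod_eq_of_lt k₀.2] using h₀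
    | succ d ih => simpa [nextIdx, Nat.add_assoc] using hP _ ih
  have h := key (mocc i - k₀.1 + k.1)
  have hk : (k₀.1 + (mocc i - k₀.1 + k.1)) % mocc i = k.1 := by
    rw [← Nat.add_assoc, Nat.add_sub_cancel' k₀.2.le, Nat.add_mod_left, Nat.mod_eq_of_lt k.2]
  simpa only [hk] using h

section PerfectMatching

variable {φ : Fin m → Fin 3 → Lit n} {mocc : Fin n → ℕ}
  {hpos : ∀ i, 0 < mocc i} {e : ∀ i, Fin (mocc i) ≃ Occ φ i}
  {M' : Set (Wt mocc × Xt mocc m × Yt mocc m)}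

/-- The element `b_k[i]` is covered by one of its two truth-setting triples. -/
theorem trueTriple_mem_or_falseTriple_mem
    (hM' : IsPerfectMatching (Matches φ mocc hpos e) M') (i : Fin n) (k : Fin (mocc i)) :
    trueTriple mocc m i k ∈ M' ∨ falseTriple hpos m i k ∈ M' := by
  obtain ⟨t, ⟨ht, hy⟩, -⟩ := hM'.2.2.2 (Sum.inl ⟨i, k⟩)
  rcases hM'.1 ht with ((⟨i', k', rfl⟩ | ⟨i', k', rfl⟩) | ⟨j, s, rfl⟩) | ⟨j, s, b, r, -, rfl⟩
  · cases Sum.inl.inj hy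
    exact Or.inl ht
  · cases Sum.inl.inj hy
    exact Or.inr ht
  · cases hy
  · cases hy

/-- The element `t[j]` is covered by a satisfaction triple. -/
theorem exists_satTriple_mem
    (hM' : IsPerfectMatching (Matches φ mocc hpos e) M') (j : Fin m) :
    ∃ s, satTriple φ e j s ∈ M' := by
  obtain ⟨t, ⟨ht, hx⟩, -⟩ := hM'.2.2.1 (Sum.inr (j, 0))
  rcases hM'.1 ht with ((⟨i, k, rfl⟩ | ⟨i, k, rfl⟩) | ⟨j', s, rfl⟩) | ⟨j', s, b, r, hr, rfl⟩
  · cases hx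
  · cases hx
  · cases Sum.inr.inj hx
    exact ⟨s, ht⟩
  · exact absurd (congrArg Prod.snd (Sum.inr.inj hx)) hr

/-- Consecutive gadget triples of opposite kinds compete for the same `a_{k+1}[i]`. -/
theorem trueTriple_nextIdx_notMem
    (hM' : IsPerfectMatching (Matches φ mocc hpos e) M') {i : Fin n} {k : Fin (mocc i)}
    (hF : falseTriple hpos m i k ∈ M') : trueTriple mocc m i (nextIdx hpos k) ∉ M' := by
  intro hT
  have h := (hM'.2.2.1 (Sum.inl ⟨i, nextIdx hpos k⟩)).unique ⟨hT, rfl⟩ ⟨hF, rfl⟩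
  simp [trueTriple, falseTriple] at h

/-- If one true triple of a gadget is chosen, all of them are. -/
theorem trueTriple_mem_of_mem
    (hM' : IsPerfectMatching (Matches φ mocc hpos e) M') {i : Fin n} {k : Fin (mocc i)}
    (hT : trueTriple mocc m i k ∈ M') (k' : Fin (mocc i)) : trueTriple mocc m i k' ∈ M' := by
  by_contra hk'
  exact forall_of_nextIdx hpos (P := fun k => trueTriple mocc m i k ∉ M')
    (fun k hk => trueTriple_nextIdx_notMem hM'
      ((trueTriple_mem_or_falseTriple_mem hM' i k).resolve_left hk)) hk' k hT

end PerfectMatching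

/-- If the constructed 3DM instance admits a perfect matching,
then the 3CNF formula `φ` is satisfiable. -/
theorem satisfiable_of_exists_perfectMatching
    {n m : ℕ} (φ : Fin m → Fin 3 → Lit n) (mocc : Fin n → ℕ)
    (hpos : ∀ i, 0 < mocc i) (e : ∀ i, Fin (mocc i) ≃ Occ φ i)
    (M' : Set (Wt mocc × Xt mocc m × Yt mocc m))
    (hM' : IsPerfectMatching (Matches φ mocc hpos e) M') :
    ∃ σ : Fin n → Bool, Satisfies φ σ := by
  classical
  refine ⟨fun i => decide (∀ k, trueTriple mocc m i k ∈ M'), fun j => ?_⟩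
  obtain ⟨s, hs⟩ := exists_satTriple_mem hM' j
  refine ⟨s, ?_⟩
  have hw := hM'.2.1 (⟨(φ j s).1, occIdx φ e j s⟩, !(φ j s).2)
  cases hpol : (φ j s).2 with
  | false =>
    refine decide_eq_false fun hall => ?_
    have h := hw.unique ⟨hs, rfl⟩ ⟨hall (occIdx φ e j s), by simp [trueTriple, hpol]⟩
    simp [satTriple, trueTriple] at h
  | true =>
    refine decide_eq_true (trueTriple_mem_of_mem hM' (k := occIdx φ e j s) ?_)
    refine (trueTriple_mem_or_falseTriple_mem hM' _ _).resolve_right fun hF => ?_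
    have h := hw.unique ⟨hs, rfl⟩ ⟨hF, by simp [falseTriple, hpol]⟩
    simp [satTriple, falseTriple] at h
end

section
/- Let W, X, Y be pairwise disjoint finite sets and let M be a finite set of triples (w, x, y) with w ∈ W, x ∈ X, y ∈ Y. Then there exists a subset M' ⊆ M in which every element of W, of X, and of Y appears in exactly one triple of M' (a perfect 3-dimensional matching) if and only if the family S = { {w, x, y} : (w, x, y) ∈ M } of 3-element subsets of U = W ∪ X ∪ Y admits a subfamily S' ⊆ S such that every element of U lies in exactly one member of S' (an exact cover by 3-sets). -/
/-- Unique existence over the image of a set on which the map is injective is unique existence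
over the set. -/
theorem Finset.existsUnique_mem_image_iff {α β : Type*} [DecidableEq β] {f : α → β} {T : Finset α}
    (hf : Set.InjOn f T) (p : β → Prop) :
    (∃! b, b ∈ T.image f ∧ p b) ↔ ∃! a, a ∈ T ∧ p (f a) := by
  constructor
  · rintro ⟨b, ⟨hb, hp⟩, huniq⟩
    obtain ⟨a, ha, rfl⟩ := Finset.mem_image.1 hb
    exact ⟨a, ⟨ha, hp⟩, fun a' h => hf h.1 ha (huniq _ ⟨Finset.mem_image_of_mem f h.1, h.2⟩)⟩
  · rintro ⟨a, ⟨ha, hp⟩, huniq⟩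
    refine ⟨f a, ⟨Finset.mem_image_of_mem f ha, hp⟩, ?_⟩
    rintro b ⟨hb, hpb⟩
    obtain ⟨a', ha', rfl⟩ := Finset.mem_image.1 hb
    rw [huniq a' ⟨ha', hpb⟩]

/-- Let `W, X, Y` be pairwise disjoint finite sets and `M` a
finite set of triples `(w, x, y)` with `w ∈ W`, `x ∈ X`, `y ∈ Y`.  Then `M`
admits a perfect 3-dimensional matching (a subset `M' ⊆ M` in which every
element of `W`, of `X`, and of `Y` appears in exactly one triple) iff the
family `S = {{w, x, y} : (w, x, y) ∈ M}` of 3-element subsets of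
`U = W ∪ X ∪ Y` admits an exact cover by 3-sets (a subfamily `S' ⊆ S` such
that every element of `U` lies in exactly one member of `S'`). -/
theorem threeDM_iff_exactCover {α : Type*} [DecidableEq α]
    (W X Y : Finset α)
    (hWX : Disjoint W X) (hWY : Disjoint W Y) (hXY : Disjoint X Y)
    (M : Finset (α × α × α))
    (hM : ∀ t ∈ M, t.1 ∈ W ∧ t.2.1 ∈ X ∧ t.2.2 ∈ Y) :
    (∃ M' ⊆ M,
        (∀ w ∈ W, ∃! t, t ∈ M' ∧ t.1 = w) ∧
        (∀ x ∈ X, ∃! t, t ∈ M' ∧ t.2.1 = x) ∧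
        (∀ y ∈ Y, ∃! t, t ∈ M' ∧ t.2.2 = y)) ↔
      (∃ S' ⊆ M.image (fun t => ({t.1, t.2.1, t.2.2} : Finset α)),
        ∀ u ∈ W ∪ X ∪ Y, ∃! s, s ∈ S' ∧ u ∈ s) := by
  have mem_W : ∀ t ∈ M, ∀ w ∈ W, w ∈ ({t.1, t.2.1, t.2.2} : Finset α) ↔ t.1 = w := by
    intro t ht w hw
    have hx := hWX.forall_ne_finset hw (hM t ht).2.1
    have hy := hWY.forall_ne_finset hw (hM t ht).2.2
    simp [hx, hy, eq_comm]
  have mem_X : ∀ t ∈ M, ∀ x ∈ X, x ∈ ({t.1, t.2.1, t.2.2} : Finset α) ↔ t.2.1 = x := by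
    intro t ht x hx
    have hw := (hWX.forall_ne_finset (hM t ht).1 hx).symm
    have hy := hXY.forall_ne_finset hx (hM t ht).2.2
    simp [hw, hy, eq_comm]
  have mem_Y : ∀ t ∈ M, ∀ y ∈ Y, y ∈ ({t.1, t.2.1, t.2.2} : Finset α) ↔ t.2.2 = y := by
    intro t ht y hy
    have hw := (hWY.forall_ne_finset (hM t ht).1 hy).symm
    have hx := (hXY.forall_ne_finset (hM t ht).2.1 hy).symm
    simp [hw, hx, eq_comm]
  have inj : Set.InjOn (fun t : α × α × α => ({t.1, t.2.1, t.2.2} : Finset α)) M := by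
    intro t ht t' ht' h
    obtain ⟨hw, hx, hy⟩ := hM t' ht'
    have h' : ∀ u, u ∈ ({t.1, t.2.1, t.2.2} : Finset α) ↔ u ∈ ({t'.1, t'.2.1, t'.2.2} : Finset α) :=
      Finset.ext_iff.1 h
    exact Prod.ext ((mem_W t ht _ hw).1 ((h' _).2 (by simp)))
      (Prod.ext ((mem_X t ht _ hx).1 ((h' _).2 (by simp)))
        ((mem_Y t ht _ hy).1 ((h' _).2 (by simp))))
  have cover_iff : ∀ T ⊆ M,
      ((∀ w ∈ W, ∃! t, t ∈ T ∧ t.1 = w) ∧ (∀ x ∈ X, ∃! t, t ∈ T ∧ t.2.1 = x) ∧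
        (∀ y ∈ Y, ∃! t, t ∈ T ∧ t.2.2 = y)) ↔
      ∀ u ∈ W ∪ X ∪ Y,
        ∃! s, s ∈ T.image (fun t => ({t.1, t.2.1, t.2.2} : Finset α)) ∧ u ∈ s := by
    intro T hT
    simp only [Finset.existsUnique_mem_image_iff (inj.mono (Finset.coe_subset.2 hT)),
      Finset.forall_mem_union, and_assoc]
    refine and_congr ?_ (and_congr ?_ ?_) <;>
      refine forall₂_congr fun u hu => existsUnique_congr fun t => and_congr_right fun ht => ?_
    · exact (mem_W t (hT ht) u hu).symm
    · exact (mem_X t (hT ht) u hu).symm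
    · exact (mem_Y t (hT ht) u hu).symm
  constructor
  · rintro ⟨T, hT, h⟩
    exact ⟨_, Finset.image_subset_image hT, (cover_iff T hT).1 h⟩
  · rintro ⟨S, hS, h⟩
    obtain ⟨T, hT, rfl⟩ := Finset.subset_image_iff.1 hS
    have hT := Finset.coe_subset.1 hT
    exact ⟨T, hT, (cover_iff T hT).2 h⟩
end

section
/- Let k ≥ 1 and work with indices r in ZMod k. For each r define the 'true' triple T_r = (r, r, (r, true)) and the 'false' triple F_r = (r + 1, r, (r, false)), triples whose first and second coordinates lie in ZMod k and whose third coordinate lies in ZMod k × Bool. If S is any subset of { T_r : r ∈ ZMod k } ∪ { F_r : r ∈ ZMod k } such that every element of ZMod k occurs exactly once as a first coordinate of a triple of S and exactly once as a second coordinate of a triple of S, then either S = { T_r : r ∈ ZMod k } or S = { F_r : r ∈ ZMod k }. -/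
/-- A predicate on `ZMod k` closed under successor and true somewhere is true everywhere. -/
theorem ZMod.forall_of_imp_add_one {k : ℕ} [NeZero k] {P : ZMod k → Prop}
    (step : ∀ r, P r → P (r + 1)) {a : ZMod k} (ha : P a) (b : ZMod k) : P b := by
  have key : ∀ n : ℕ, P (a + n) := by
    intro n
    induction n with
    | zero => simpa using ha
    | succ n ih => simpa [add_assoc] using step _ ih
  simpa using key (b - a).val

/-- Correctness of the cyclic truth-setting gadget.  Indices
live in `ZMod k` (`k ≥ 1`); the "true" triple is `T_r = (r, r, (r, true))` and
the "false" triple is `F_r = (r + 1, r, (r, false))`.  Any subset `S` of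
`{T_r} ∪ {F_r}` in which every element of `ZMod k` occurs exactly once as a
first coordinate and exactly once as a second coordinate is either the
all-true family or the all-false family. -/
theorem truthSetting_gadget_consistent (k : ℕ) (hk : 1 ≤ k)
    (S : Set (ZMod k × ZMod k × (ZMod k × Bool)))
    (hsub : S ⊆ {t | ∃ r : ZMod k, t = (r, r, (r, true))}
        ∪ {t | ∃ r : ZMod k, t = (r + 1, r, (r, false))})
    (hfst : ∀ a : ZMod k, ∃! t, t ∈ S ∧ t.1 = a)
    (hsnd : ∀ b : ZMod k, ∃! t, t ∈ S ∧ t.2.1 = b) :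
    S = {t | ∃ r : ZMod k, t = (r, r, (r, true))} ∨
      S = {t | ∃ r : ZMod k, t = (r + 1, r, (r, false))} := by
  have : NeZero k := ⟨by omega⟩
  have not_both : ∀ r : ZMod k, (r, r, (r, true)) ∈ S → (r + 1, r, (r, false)) ∉ S := by
    intro r hT hF
    have h := (hsnd r).unique ⟨hT, rfl⟩ ⟨hF, rfl⟩
    simp at h
  have some_snd : ∀ r : ZMod k, (r, r, (r, true)) ∈ S ∨ (r + 1, r, (r, false)) ∈ S := by
    intro r
    obtain ⟨t, ⟨ht, rfl⟩, -⟩ := hsnd r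
    obtain ⟨s, rfl⟩ | ⟨s, rfl⟩ := hsub ht
    · exact Or.inl ht
    · exact Or.inr ht
  have step : ∀ r : ZMod k, (r, r, (r, true)) ∈ S →
      (r + 1, r + 1, (r + 1, true)) ∈ S := by
    intro r hT
    obtain ⟨t, ⟨ht, htr⟩, -⟩ := hfst (r + 1)
    obtain ⟨s, rfl⟩ | ⟨s, rfl⟩ := hsub ht
    · obtain rfl : s = r + 1 := htr
      exact ht
    · obtain rfl : s = r := add_right_cancel htr
      exact absurd ht (not_both s hT)
  by_cases h : ∃ a : ZMod k, (a, a, (a, true)) ∈ S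
  · obtain ⟨a, ha⟩ := h
    have all_true := ZMod.forall_of_imp_add_one
      (P := fun r => (r, r, (r, true)) ∈ S) step ha
    left
    refine Set.Subset.antisymm (fun t ht => (hsub ht).resolve_right ?_) ?_
    · rintro ⟨r, rfl⟩
      exact not_both r (all_true r) ht
    · rintro _ ⟨r, rfl⟩
      exact all_true r
  · right
    refine Set.Subset.antisymm (fun t ht => (hsub ht).resolve_left ?_) ?_
    · rintro ⟨r, rfl⟩
      exact h ⟨r, ht⟩
    · rintro _ ⟨r, rfl⟩
      exact (some_snd r).resolve_left fun hT => h ⟨r, hT⟩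
end
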